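/- Let 𝒞 be a hereditary class of graphs and let p be a positive integer. If there is a function f such that χ_p(G) ≤ f(ω(TM_{p-1}(G))) holds for all G ∈ 𝒞, then the class ITM_{p-1}^e(𝒞) is χ-bounded. -/

import Mathlib

open SimpleGraph

/-! ## Basic containment relations between graphs -/

/-- `H` is isomorphic to a (not necessarily induced) subgraph of `G`. -/
def IsSubgraphOf {V W : Type*} (H : SimpleGraph V) (G : SimpleGraph W) : Prop :=
  ∃ f : H →g G, Function.Injective f

/-- `H` is isomorphic to an induced subgraph of `G`. -/
def IsInducedSubgraphOf {V W : Type*} (H : SimpleGraph V) (G : SimpleGraph W) : Prop :=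
  Nonempty (H ↪g G)

/-- The clique number `ω(G)`: the largest `m` such that `K_m` is a subgraph of `G`. -/
noncomputable def omegaNum {V : Type*} (G : SimpleGraph V) : ℕ :=
  sSup {m | IsSubgraphOf (⊤ : SimpleGraph (Fin m)) G}

/-- The chromatic number `χ(G)` (as a natural number). -/
noncomputable def chi {V : Type*} (G : SimpleGraph V) : ℕ :=
  sInf {N | G.Colorable N}

/-! ## Tree-depth and the invariants `χ_p` -/

/-- A forest order: a partial order in which the down-set of every element is a chain.
Such orders are exactly the ancestor orders of rooted forests. -/
def IsForestOrder {V : Type*} (r : V → V → Prop) : Prop :=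
  (∀ v, r v v) ∧ (∀ u v, r u v → r v u → u = v) ∧
  (∀ u v w, r u v → r v w → r u w) ∧
  (∀ u v w, r u w → r v w → r u v ∨ r v u)

/-- `G` has tree-depth at most `h`: `G` is a subgraph of the closure of a rooted forest
of height at most `h` (height = maximum number of vertices on a root-to-leaf path). -/
def TreeDepthLE {V : Type*} (G : SimpleGraph V) (h : ℕ) : Prop :=
  ∃ r : V → V → Prop, IsForestOrder r ∧
    (∀ u v, G.Adj u v → r u v ∨ r v u) ∧
    (∀ v, {u | r u v}.ncard ≤ h)

/-- The tree-depth `td(G)`. -/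
noncomputable def treeDepth {V : Type*} (G : SimpleGraph V) : ℕ :=
  sInf {h | TreeDepthLE G h}

/-- `χ_p(G)`: the least number of colors of a vertex coloring such that every set `I` of at
most `p` colors induces a subgraph of tree-depth at most `|I|`. -/
noncomputable def chiP {V : Type*} (G : SimpleGraph V) (p : ℕ) : ℕ :=
  sInf {N | ∃ c : V → Fin N, ∀ I : Finset (Fin N), I.card ≤ p →
    TreeDepthLE (G.induce {v | c v ∈ I}) I.card}

/-! ## Star colorings -/

/-- A star coloring: a proper coloring with no path on `4` vertices using only two colors. -/
def IsStarColoring {V α : Type*} (G : SimpleGraph V) (c : V → α) : Prop :=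
  (∀ u v, G.Adj u v → c u ≠ c v) ∧
  ∀ x y z w : V, G.Adj x y → G.Adj y z → G.Adj z w →
    x ≠ z → y ≠ w → x ≠ w → ¬(c x = c z ∧ c y = c w)

/-- The star chromatic number `χ_s(G)`. -/
noncomputable def starChi {V : Type*} (G : SimpleGraph V) : ℕ :=
  sInf {N | ∃ c : V → Fin N, IsStarColoring G c}

/-! ## Subdivisions -/

/-- The edges of a graph on `Fin n`, presented as increasingly ordered pairs. -/
def Edges {n : ℕ} (H : SimpleGraph (Fin n)) : Type :=
  {p : Fin n × Fin n // p.1 < p.2 ∧ H.Adj p.1 p.2}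

/-- Base relation of the subdivision of `H`, where the edge `e` receives `t e` internal
vertices. -/
def subdivRel {n : ℕ} (H : SimpleGraph (Fin n)) (t : Edges H → ℕ) :
    (Fin n ⊕ Σ e : Edges H, Fin (t e)) → (Fin n ⊕ Σ e : Edges H, Fin (t e)) → Prop
  | Sum.inl u, Sum.inl v => ∃ h : u < v ∧ H.Adj u v, t ⟨(u, v), h⟩ = 0
  | Sum.inl u, Sum.inr ⟨e, i⟩ =>
      (u = e.1.1 ∧ (i : ℕ) = 0) ∨ (u = e.1.2 ∧ (i : ℕ) + 1 = t e)
  | Sum.inr ⟨e, i⟩, Sum.inr ⟨e', j⟩ => e = e' ∧ (i : ℕ) + 1 = (j : ℕ)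
  | _, _ => False

/-- The subdivision of `H` in which each edge `e` is replaced by a path with exactly `t e`
internal vertices. In particular `Subdiv H (fun _ => r)` is the `r`-subdivision `H^{(r)}`,
and the `(≤ r)`-subdivisions of `H` are the graphs `Subdiv H t` with `t e ≤ r` for all `e`. -/
def Subdiv {n : ℕ} (H : SimpleGraph (Fin n)) (t : Edges H → ℕ) :
    SimpleGraph (Fin n ⊕ Σ e : Edges H, Fin (t e)) :=
  SimpleGraph.fromRel (subdivRel H t)

/-- `H ∈ TM_r(G)`: some `(≤ r)`-subdivision of `H` is a subgraph of `G`. -/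
def MemTM {W : Type*} (r : ℕ) (G : SimpleGraph W) {n : ℕ} (H : SimpleGraph (Fin n)) : Prop :=
  ∃ t : Edges H → ℕ, (∀ e, t e ≤ r) ∧ IsSubgraphOf (Subdiv H t) G

/-- `H ∈ ITM_r^e(G)`: the exact `r`-subdivision of `H` is an induced subgraph of `G`. -/
def MemITM {W : Type*} (r : ℕ) (G : SimpleGraph W) {n : ℕ} (H : SimpleGraph (Fin n)) : Prop :=
  IsInducedSubgraphOf (Subdiv H (fun _ => r)) G

/-- `ω(TM_r(G))`: the supremum of the clique numbers of the graphs in `TM_r(G)`. -/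
noncomputable def omegaTM {W : Type*} (r : ℕ) (G : SimpleGraph W) : ℕ :=
  sSup {m | ∃ (k : ℕ) (H : SimpleGraph (Fin k)), MemTM r G H ∧ omegaNum H = m}

/-- The biclique number `bω(G)`: the largest `s` with `K_{s,s}` a subgraph of `G`. -/
noncomputable def bomega {V : Type*} (G : SimpleGraph V) : ℕ :=
  sSup {s | IsSubgraphOf (completeBipartiteGraph (Fin s) (Fin s)) G}

/-- The average degree `d̄(G) = 2|E(G)|/|V(G)|`. -/
noncomputable def avgDeg {n : ℕ} (G : SimpleGraph (Fin n)) : ℝ :=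
  2 * (G.edgeSet.ncard : ℝ) / n

/-! ## Classes of graphs -/

/-- A class of (finite, simple) graphs: for each `n`, a set of graphs on `Fin n`.
Classes are implicitly closed under isomorphism via the relations used below. -/
def GraphClass := ∀ n : ℕ, Set (SimpleGraph (Fin n))

/-- A hereditary class: closed under induced subgraphs (hence under isomorphism). -/
def Hereditary (C : GraphClass) : Prop :=
  ∀ ⦃n m : ℕ⦄ (G : SimpleGraph (Fin n)) (H : SimpleGraph (Fin m)),
    G ∈ C n → IsInducedSubgraphOf H G → H ∈ C m

/-- A monotone class: closed under subgraphs (hence under isomorphism). -/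
def MonotoneClass (C : GraphClass) : Prop :=
  ∀ ⦃n m : ℕ⦄ (G : SimpleGraph (Fin n)) (H : SimpleGraph (Fin m)),
    G ∈ C n → IsSubgraphOf H G → H ∈ C m

/-- `H ∈ TM_r(𝒞)`. -/
def MemTMClass (r : ℕ) (C : GraphClass) {m : ℕ} (H : SimpleGraph (Fin m)) : Prop :=
  ∃ (n : ℕ) (G : SimpleGraph (Fin n)), G ∈ C n ∧ MemTM r G H

/-- `H ∈ ITM_r^e(𝒞)`. -/
def MemITMClass (r : ℕ) (C : GraphClass) {m : ℕ} (H : SimpleGraph (Fin m)) : Prop :=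
  ∃ (n : ℕ) (G : SimpleGraph (Fin n)), G ∈ C n ∧ MemITM r G H

/-- `𝒞` is `χ`-bounded: `χ(H) ≤ f(ω(H))` for every induced subgraph `H` of a graph of `𝒞`. -/
def ChiBounded (C : GraphClass) : Prop :=
  ∃ f : ℕ → ℕ, ∀ ⦃n : ℕ⦄ (G : SimpleGraph (Fin n)), G ∈ C n →
    ∀ ⦃m : ℕ⦄ (H : SimpleGraph (Fin m)), IsInducedSubgraphOf H G →
      chi H ≤ f (omegaNum H)

/-- `𝒞` has bounded expansion: for every `r`, `d̄(TM_r(𝒞)) < ∞`. -/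
def BoundedExpansion (C : GraphClass) : Prop :=
  ∀ r : ℕ, ∃ d : ℝ, ∀ ⦃m : ℕ⦄ (H : SimpleGraph (Fin m)), MemTMClass r C H → avgDeg H ≤ d

/-- `𝒞` has `ω`-bounded expansion. -/
def OmegaBoundedExpansion (C : GraphClass) : Prop :=
  ∃ f : ℕ → ℕ → ℝ, ∀ ⦃n : ℕ⦄ (G : SimpleGraph (Fin n)), G ∈ C n →
    ∀ (r : ℕ) ⦃m : ℕ⦄ (H : SimpleGraph (Fin m)), MemTM r G H →
      avgDeg H ≤ f (omegaNum G) r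

/-- `𝒞` is nowhere dense: for every `r`, `ω(TM_r(𝒞)) < ∞`. -/
def NowhereDense (C : GraphClass) : Prop :=
  ∀ r : ℕ, ∃ c : ℕ, ∀ ⦃m : ℕ⦄ (H : SimpleGraph (Fin m)), MemTMClass r C H → omegaNum H ≤ c

/-- `𝒞` is strongly `χ_p`-bounded: `χ_p(G) ≤ f_p(ω(G))` on `𝒞`. -/
def StronglyChiPBounded (C : GraphClass) (p : ℕ) : Prop :=
  ∃ f : ℕ → ℕ, ∀ ⦃n : ℕ⦄ (G : SimpleGraph (Fin n)), G ∈ C n → chiP G p ≤ f (omegaNum G)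

/-- `𝒞` is weakly `χ_p`-bounded: `χ_p(G) ≤ g_p(ω(TM_{p-1}(G)))` on `𝒞`. -/
def WeaklyChiPBounded (C : GraphClass) (p : ℕ) : Prop :=
  ∃ g : ℕ → ℕ, ∀ ⦃n : ℕ⦄ (G : SimpleGraph (Fin n)), G ∈ C n → chiP G p ≤ g (omegaTM (p - 1) G)

/-! ## Directed graphs, orientations and restricted dualities -/

/-- Existence of a homomorphism between directed graphs presented as binary relations. -/
def DigraphHomEx {n m : ℕ} (A : Fin n → Fin n → Prop) (B : Fin m → Fin m → Prop) : Prop :=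
  ∃ f : Fin n → Fin m, ∀ u v, A u v → B (f u) (f v)

/-- `A` is an orientation of the graph `G`. -/
def IsOrientationOf {n : ℕ} (A : Fin n → Fin n → Prop) (G : SimpleGraph (Fin n)) : Prop :=
  (∀ u v, ¬(A u v ∧ A v u)) ∧ (∀ u v, G.Adj u v ↔ (A u v ∨ A v u))

/-- A directed graph is acyclic if it has no directed cycle. -/
def IsAcyclicDigraph {n : ℕ} (A : Fin n → Fin n → Prop) : Prop :=
  ∀ v, ¬ Relation.TransGen A v v

/-- The directed graph `F` has a restricted dual for the class of all orientations of the
graphs of `𝒞`. -/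
def HasRestrictedDualForOrientations (C : GraphClass) {nF : ℕ}
    (F : Fin nF → Fin nF → Prop) : Prop :=
  ∃ (m : ℕ) (D : Fin m → Fin m → Prop),
    ¬ DigraphHomEx F D ∧
    ∀ ⦃n : ℕ⦄ (A : Fin n → Fin n → Prop) (G : SimpleGraph (Fin n)),
      G ∈ C n → IsOrientationOf A G →
      (¬ DigraphHomEx F A ↔ DigraphHomEx A D)

/-! ## Holes -/

/-- The number `h_g(G)` of holes of length `g` in `G`, i.e. of vertex subsets inducing a
cycle on `g` vertices. -/
noncomputable def holeCount {n : ℕ} (g : ℕ) (G : SimpleGraph (Fin n)) : ℕ :=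
  {S : Set (Fin n) | Nonempty (G.induce S ≃g SimpleGraph.cycleGraph g)}.ncard

/-- `G` is even hole-free: it has no induced cycle of even length at least `4`. -/
def EvenHoleFree {n : ℕ} (G : SimpleGraph (Fin n)) : Prop :=
  ∀ g : ℕ, 4 ≤ g → Even g → holeCount g G = 0

/-! ## Clique number and chromatic number -/

theorem bddAbove_clique_sizes {k : ℕ} (K : SimpleGraph (Fin k)) :
    BddAbove {m | IsSubgraphOf (⊤ : SimpleGraph (Fin m)) K} := by
  refine ⟨k, ?_⟩
  rintro m ⟨g, hg⟩
  simpa using Fintype.card_le_of_injective g hg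

theorem le_omegaNum {k m : ℕ} {K : SimpleGraph (Fin k)}
    (h : IsSubgraphOf (⊤ : SimpleGraph (Fin m)) K) : m ≤ omegaNum K :=
  le_csSup (bddAbove_clique_sizes K) h

theorem top_isSubgraphOf_omegaNum {k : ℕ} (K : SimpleGraph (Fin k)) :
    IsSubgraphOf (⊤ : SimpleGraph (Fin (omegaNum K))) K := by
  refine Nat.sSup_mem (s := {m | IsSubgraphOf (⊤ : SimpleGraph (Fin m)) K})
    ⟨0, ⟨⟨fun i => i.elim0, fun {i} => i.elim0⟩, fun i => i.elim0⟩⟩ (bddAbove_clique_sizes K)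

theorem omegaNum_congr {V W : Type*} {G : SimpleGraph V} {G' : SimpleGraph W} (e : G ≃g G') :
    omegaNum G = omegaNum G' := by
  unfold omegaNum
  congr 1
  ext m
  constructor
  · rintro ⟨g, hg⟩
    exact ⟨e.toHom.comp g, e.injective.comp hg⟩
  · rintro ⟨g, hg⟩
    exact ⟨e.symm.toHom.comp g, e.symm.injective.comp hg⟩

theorem SimpleGraph.Colorable.chi_le {V : Type*} {G : SimpleGraph V} {n : ℕ}
    (h : G.Colorable n) : chi G ≤ n :=
  Nat.sInf_le h

/-- A graph in which every nonempty vertex set contains a vertex with at most `k` neighbours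
in that set is `(k + 1)`-colorable. -/
theorem colorable_of_degenerate {V : Type*} [Fintype V] (G : SimpleGraph V) (k : ℕ)
    (h : ∀ S : Finset V, S.Nonempty → ∃ u ∈ S, {v | v ∈ S ∧ G.Adj u v}.ncard ≤ k) :
    G.Colorable (k + 1) := by
  classical
  have key : ∀ S : Finset V, ∃ col : V → Fin (k + 1),
      ∀ u ∈ S, ∀ v ∈ S, G.Adj u v → col u ≠ col v := by
    intro S
    induction S using Finset.strongInduction with
    | H S ih =>
      rcases S.eq_empty_or_nonempty with rfl | hS
      · exact ⟨fun _ => 0, by simp⟩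
      obtain ⟨u, hu, hk⟩ := h S hS
      obtain ⟨col, hcol⟩ := ih (S.erase u) (Finset.erase_ssubset hu)
      obtain ⟨a, ha⟩ : ∃ a, a ∉ col '' {v | v ∈ S ∧ G.Adj u v} := by
        by_contra! hall
        have h1 : (col '' {v | v ∈ S ∧ G.Adj u v}) = Set.univ :=
          Set.eq_univ_of_forall hall
        have h2 := Set.ncard_image_le (f := col) (Set.toFinite {v | v ∈ S ∧ G.Adj u v})
        rw [h1, Set.ncard_univ, Nat.card_eq_fintype_card, Fintype.card_fin] at h2
        omega
      refine ⟨Function.update col u a, ?_⟩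
      intro x hx y hy hxy
      by_cases hxu : x = u
      · subst hxu
        have hyx : y ≠ x := hxy.ne'
        rw [Function.update_self, Function.update_of_ne hyx]
        rintro rfl
        exact ha ⟨y, ⟨hy, hxy⟩, rfl⟩
      · by_cases hyu : y = u
        · subst hyu
          rw [Function.update_self, Function.update_of_ne hxu]
          rintro rfl
          exact ha ⟨x, ⟨hx, hxy.symm⟩, rfl⟩
        · rw [Function.update_of_ne hxu, Function.update_of_ne hyu]
          exact hcol x (by simp [hxu, hx]) y (by simp [hyu, hy]) hxy
  obtain ⟨col, hcol⟩ := key Finset.univ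
  exact ⟨Coloring.mk col fun {u v} huv => hcol u (by simp) v (by simp) huv⟩

/-! ## Tree-depth -/

theorem treeDepthLE_of_card_le {V : Type*} [Finite V] (G : SimpleGraph V) {h : ℕ}
    (hV : Nat.card V ≤ h) : TreeDepthLE G h := by
  let e := Finite.equivFin V
  refine ⟨fun u v => e u ≤ e v, ⟨fun v => le_rfl, fun u v h1 h2 => e.injective (le_antisymm h1 h2),
    fun u v w => le_trans, fun u v w _ _ => le_total _ _⟩, fun u v _ => le_total _ _, fun v => ?_⟩
  refine le_trans (Set.ncard_le_ncard (Set.subset_univ _)) ?_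
  rwa [Set.ncard_univ]

/-- The infimum defining `chiP` is attained. -/
theorem exists_coloring_chiP {n : ℕ} (G : SimpleGraph (Fin n)) (p : ℕ) :
    ∃ c : Fin n → Fin (chiP G p), ∀ I : Finset (Fin (chiP G p)), I.card ≤ p →
      TreeDepthLE (G.induce {v | c v ∈ I}) I.card := by
  refine Nat.sInf_mem (s := {N | ∃ c : Fin n → Fin N, ∀ I : Finset (Fin N), I.card ≤ p →
    TreeDepthLE (G.induce {v | c v ∈ I}) I.card}) ⟨n, id, fun I _ => ?_⟩
  refine treeDepthLE_of_card_le _ ?_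
  simp

/-- A sequence of consecutively comparable elements in a forest order has a minimum. -/
theorem exists_min_of_comparable {X : Type*} {R : X → X → Prop}
    (htrans : ∀ u v w, R u v → R v w → R u w)
    (hforest : ∀ u v w, R u w → R v w → R u v ∨ R v u)
    (w : ℕ → X) (n : ℕ) (hrefl : ∀ i, R (w i) (w i))
    (h : ∀ i < n, R (w i) (w (i + 1)) ∨ R (w (i + 1)) (w i)) :
    ∃ j ≤ n, ∀ i ≤ n, R (w j) (w i) := by
  induction n with
  | zero =>
    refine ⟨0, le_rfl, fun i hi => ?_⟩
    obtain rfl : i = 0 := by omega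
    exact hrefl 0
  | succ n ih =>
    obtain ⟨j, hj, hmin⟩ := ih fun i hi => h i (by omega)
    have hcomp : R (w j) (w (n + 1)) ∨ R (w (n + 1)) (w j) := by
      rcases h n (by omega) with h1 | h1
      · exact Or.inl (htrans _ _ _ (hmin n le_rfl) h1)
      · exact hforest _ _ _ (hmin n le_rfl) h1
    rcases hcomp with h1 | h1
    · refine ⟨j, by omega, fun i hi => ?_⟩
      rcases Nat.lt_or_ge n i with h2 | h2
      · obtain rfl : i = n + 1 := by omega
        exact h1
      · exact hmin i h2
    · refine ⟨n + 1, le_rfl, fun i hi => ?_⟩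
      rcases Nat.lt_or_ge n i with h2 | h2
      · obtain rfl : i = n + 1 := by omega
        exact hrefl _
      · exact htrans _ _ _ h1 (hmin i h2)

/-! ## Structure of subdivisions -/

section Subdivision

variable {n : ℕ} {H : SimpleGraph (Fin n)} {t : Edges H → ℕ}

instance : Finite (Edges H) :=
  inferInstanceAs (Finite {p : Fin n × Fin n // p.1 < p.2 ∧ H.Adj p.1 p.2})

/-- The path replacing the edge `e`, prolonged by its last vertex. -/
def subdivPath (t : Edges H → ℕ) (e : Edges H) (i : ℕ) : Fin n ⊕ Σ e : Edges H, Fin (t e) :=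
  if i = 0 then Sum.inl e.1.1
  else if h : i - 1 < t e then Sum.inr ⟨e, ⟨i - 1, h⟩⟩ else Sum.inl e.1.2

theorem subdivPath_zero (e : Edges H) : subdivPath t e 0 = Sum.inl e.1.1 := rfl

theorem subdivPath_of_lt {e : Edges H} {i : ℕ} (h : i < t e) :
    subdivPath t e (i + 1) = Sum.inr ⟨e, ⟨i, h⟩⟩ := by
  simp [subdivPath, h]

theorem subdivPath_of_gt {e : Edges H} {i : ℕ} (h : t e < i) :
    subdivPath t e i = Sum.inl e.1.2 := by
  have h1 : i ≠ 0 := by omega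
  have h2 : ¬ i - 1 < t e := by omega
  simp [subdivPath, h1, h2]

theorem subdivPath_cases (e : Edges H) (i : ℕ) :
    subdivPath t e i = Sum.inl e.1.1 ∨ subdivPath t e i = Sum.inl e.1.2 ∨
      ∃ j, subdivPath t e i = Sum.inr ⟨e, j⟩ := by
  unfold subdivPath
  split_ifs
  · exact Or.inl rfl
  · exact Or.inr (Or.inr ⟨_, rfl⟩)
  · exact Or.inr (Or.inl rfl)

theorem subdivPath_adj {e : Edges H} {i : ℕ} (h : i ≤ t e) :
    (Subdiv H t).Adj (subdivPath t e i) (subdivPath t e (i + 1)) := by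
  have hne : e.1.1 ≠ e.1.2 := e.2.1.ne
  rw [Subdiv, fromRel_adj]
  rcases i with _ | i
  · rw [subdivPath_zero]
    rcases Nat.eq_zero_or_pos (t e) with h0 | h0
    · rw [subdivPath_of_gt (by omega)]
      exact ⟨by simpa using hne, Or.inl ⟨e.2, h0⟩⟩
    · rw [subdivPath_of_lt h0]
      exact ⟨by simp, Or.inl (Or.inl ⟨rfl, rfl⟩)⟩
  · have hi : i < t e := h
    rw [subdivPath_of_lt hi]
    rcases Nat.lt_or_ge (i + 1) (t e) with h1 | h1
    · rw [subdivPath_of_lt h1]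
      exact ⟨by simp, Or.inl ⟨rfl, rfl⟩⟩
    · rw [subdivPath_of_gt (by omega)]
      exact ⟨by simp, Or.inr (Or.inr ⟨rfl, by simp; omega⟩)⟩

theorem eq_subdivPath_of_adj_inr {e : Edges H} {i : Fin (t e)}
    {z : Fin n ⊕ Σ e : Edges H, Fin (t e)} (h : (Subdiv H t).Adj (Sum.inr ⟨e, i⟩) z) :
    z = subdivPath t e i ∨ z = subdivPath t e (i + 2) := by
  rw [Subdiv, fromRel_adj] at h
  obtain ⟨-, h⟩ := h
  rcases z with u | ⟨e', j⟩
  · rcases h with h | h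
    · exact h.elim
    · rcases h with ⟨rfl, h⟩ | ⟨rfl, h⟩
      · left; rw [h, subdivPath_zero]
      · right; rw [subdivPath_of_gt (by omega)]
  · rcases h with ⟨rfl, h⟩ | ⟨rfl, h⟩
    · right
      have : (i : ℕ) + 2 = j + 1 := by omega
      rw [this, subdivPath_of_lt j.2]
    · left
      rw [← h, subdivPath_of_lt j.2]

/-- The vertex `z` is `v` or subdivides the edge `uv`. -/
def LiesToward (t : Edges H → ℕ) (u : Fin n) (z : Fin n ⊕ Σ e : Edges H, Fin (t e))
    (v : Fin n) : Prop :=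
  z = Sum.inl v ∨ ∃ e i, z = Sum.inr ⟨e, i⟩ ∧ s(e.1.1, e.1.2) = s(u, v)

theorem LiesToward.unique {u v v' : Fin n} {z : Fin n ⊕ Σ e : Edges H, Fin (t e)}
    (h : LiesToward t u z v) (h' : LiesToward t u z v') : v = v' := by
  rcases h with rfl | ⟨e, i, rfl, h⟩ <;> rcases h' with h' | ⟨e', i', h', h''⟩
  · simpa using h'
  · simp at h'
  · simp at h'
  · cases h'
    rw [h] at h''
    exact Sym2.congr_right.1 h''

theorem liesToward_subdivPath {e : Edges H} {u v : Fin n} {i : ℕ}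
    (he : s(e.1.1, e.1.2) = s(u, v)) (h : subdivPath t e i ≠ Sum.inl u) :
    LiesToward t u (subdivPath t e i) v := by
  rcases subdivPath_cases (t := t) e i with h1 | h1 | ⟨j, h1⟩
  · rw [h1] at h ⊢
    rcases Sym2.eq_iff.1 he with ⟨h2, h3⟩ | ⟨h2, h3⟩
    · exact absurd (by rw [h2]) h
    · exact Or.inl (by rw [h2])
  · rw [h1] at h ⊢
    rcases Sym2.eq_iff.1 he with ⟨h2, h3⟩ | ⟨h2, h3⟩
    · exact Or.inl (by rw [h3])
    · exact absurd (by rw [h3]) h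
  · exact Or.inr ⟨e, j, h1, he⟩

theorem exists_edge_of_adj {u v : Fin n} (h : H.Adj u v) :
    ∃ e : Edges H, s(e.1.1, e.1.2) = s(u, v) := by
  rcases lt_or_gt_of_ne h.ne with h1 | h1
  · exact ⟨⟨(u, v), h1, h⟩, rfl⟩
  · exact ⟨⟨(v, u), h1, h.symm⟩, Sym2.eq_swap⟩

theorem exists_adj_liesToward (t : Edges H → ℕ) {u v : Fin n} (h : H.Adj u v) :
    ∃ z, (Subdiv H t).Adj (Sum.inl u) z ∧ LiesToward t u z v := by
  obtain ⟨e, he⟩ := exists_edge_of_adj h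
  rcases Sym2.eq_iff.1 he with ⟨h2, h3⟩ | ⟨h2, h3⟩
  · have := subdivPath_adj (t := t) (e := e) (Nat.zero_le _)
    rw [subdivPath_zero, h2] at this
    exact ⟨_, this, liesToward_subdivPath he this.ne'⟩
  · have := (subdivPath_adj (t := t) (e := e) le_rfl).symm
    rw [subdivPath_of_gt (Nat.lt_succ_self _), h3] at this
    exact ⟨_, this, liesToward_subdivPath he this.ne'⟩

/-- In an `r`-subdivision, distinct original vertices joined by a walk of length at most
`r + 1` are adjacent in the original graph. -/
theorem adj_of_short_walk {r : ℕ} {x y : Fin n} (hxy : x ≠ y)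
    (z : ℕ → Fin n ⊕ Σ _ : Edges H, Fin r) (l : ℕ) (hl : l ≤ r + 1)
    (hz0 : z 0 = Sum.inl x) (hzl : z l = Sum.inl y)
    (hz : ∀ i < l, (Subdiv H fun _ => r).Adj (z i) (z (i + 1))) : H.Adj x y := by
  have key : ∀ s ≤ l, z s = Sum.inl x ∨
      (∃ e i, z s = Sum.inr ⟨e, i⟩ ∧
        ((e.1.1 = x ∧ (i : ℕ) + 1 ≤ s) ∨ (e.1.2 = x ∧ r ≤ s + i))) ∨
      (∃ y, z s = Sum.inl y ∧ H.Adj x y ∧ r + 1 ≤ s) := by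
    intro s
    induction s with
    | zero => exact fun _ => Or.inl hz0
    | succ s ih =>
      intro hs
      have hadj := hz s (by omega)
      rw [Subdiv, fromRel_adj] at hadj
      obtain ⟨-, hadj⟩ := hadj
      rcases ih (by omega) with h | ⟨e, i, h, hi⟩ | ⟨y, -, -, h⟩
      · rw [h] at hadj
        rcases hz' : z (s + 1) with u | ⟨e', j⟩ <;> rw [hz'] at hadj
        · right; right
          rcases hadj with ⟨h1, h2⟩ | ⟨h1, h2⟩ <;> change r = 0 at h2
          · exact ⟨u, rfl, h1.2, by omega⟩
          · exact ⟨u, rfl, h1.2.symm, by omega⟩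
        · right; left
          refine ⟨e', j, rfl, ?_⟩
          rcases hadj with (⟨h1, h2⟩ | ⟨h1, h2⟩) | h1
          · exact Or.inl ⟨h1.symm, by omega⟩
          · change (j : ℕ) + 1 = r at h2
            exact Or.inr ⟨h1.symm, by omega⟩
          · exact h1.elim
      · rw [h] at hadj
        rcases hz' : z (s + 1) with u | ⟨e', j⟩ <;> rw [hz'] at hadj
        · rcases hadj with h1 | h1
          · exact h1.elim
          · have hlt := i.2
            rcases h1 with ⟨rfl, h1⟩ | ⟨rfl, h1⟩ <;> dsimp only at h1 <;> rcases hi with ⟨rfl, hi⟩ | ⟨rfl, hi⟩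
            · exact Or.inl rfl
            · exact Or.inr (Or.inr ⟨_, rfl, e.2.2.symm, by omega⟩)
            · exact Or.inr (Or.inr ⟨_, rfl, e.2.2, by omega⟩)
            · exact Or.inl rfl
        · right; left
          refine ⟨e', j, rfl, ?_⟩
          rcases hadj with ⟨rfl, h1⟩ | ⟨rfl, h1⟩ <;> rcases hi with ⟨h2, hi⟩ | ⟨h2, hi⟩
          · exact Or.inl ⟨h2, by omega⟩
          · exact Or.inr ⟨h2, by omega⟩
          · exact Or.inl ⟨h2, by omega⟩
          · exact Or.inr ⟨h2, by omega⟩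
      · omega
  rcases key l le_rfl with h | ⟨e, i, h, -⟩ | ⟨y', h, h1, -⟩
  · rw [hzl] at h
    exact absurd (Sum.inl.inj h).symm hxy
  · rw [hzl] at h
    cases h
  · rw [hzl] at h
    rwa [Sum.inl.inj h]

end Subdivision

/-! ## Clique numbers of topological minors of subdivisions -/

theorem omegaNum_le_of_subdiv_isSubgraphOf {k m r : ℕ} {K : SimpleGraph (Fin k)}
    {H : SimpleGraph (Fin m)} {t : Edges K → ℕ} (ht : ∀ e, t e ≤ r)
    (hsub : IsSubgraphOf (Subdiv K t) (Subdiv H fun _ => r)) :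
    omegaNum K ≤ max (omegaNum H) 3 := by
  obtain ⟨φ, hφ⟩ := hsub
  obtain ⟨g, hg⟩ := top_isSubgraphOf_omegaNum K
  by_contra! hlt
  obtain ⟨hlt, h3⟩ := max_lt_iff.1 hlt
  have hadj : ∀ a b, a ≠ b → K.Adj (g a) (g b) := fun a b hab => g.map_adj (by simpa using hab)
  have hbranch : ∀ a, ∃ x, φ (Sum.inl (g a)) = Sum.inl x := by
    intro a
    rcases hx : φ (Sum.inl (g a)) with x | ⟨e, i⟩
    · exact ⟨x, rfl⟩
    have hcard : 2 < (Finset.univ.erase a).card := by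
      rw [Finset.card_erase_of_mem (Finset.mem_univ a), Finset.card_univ, Fintype.card_fin]
      omega
    obtain ⟨b₁, h₁, b₂, h₂, b₃, h₃, h₁₂, h₁₃, h₂₃⟩ := Finset.two_lt_card.1 hcard
    have hz : ∀ b ∈ Finset.univ.erase a, ∃ z, LiesToward t (g a) z (g b) ∧
        (φ z = subdivPath (fun _ => r) e i ∨ φ z = subdivPath (fun _ => r) e (i + 2)) := by
      intro b hb
      obtain ⟨z, hz, hl⟩ := exists_adj_liesToward t (hadj a b (Finset.ne_of_mem_erase hb).symm)
      have h := φ.map_adj hz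
      rw [hx] at h
      exact ⟨z, hl, eq_subdivPath_of_adj_inr h⟩
    obtain ⟨z₁, l₁, c₁⟩ := hz b₁ h₁
    obtain ⟨z₂, l₂, c₂⟩ := hz b₂ h₂
    obtain ⟨z₃, l₃, c₃⟩ := hz b₃ h₃
    have hne : ∀ {b b' z z'}, b ≠ b' → LiesToward t (g a) z (g b) →
        LiesToward t (g a) z' (g b') → φ z ≠ φ z' := by
      intro b b' z z' hb l l' h
      have := hφ h
      subst this
      exact hb (hg (l.unique l'))
    have n₁₂ := hne h₁₂ l₁ l₂
    have n₁₃ := hne h₁₃ l₁ l₃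
    have n₂₃ := hne h₂₃ l₂ l₃
    rcases c₁ with c₁ | c₁ <;> rcases c₂ with c₂ | c₂ <;> rcases c₃ with c₃ | c₃ <;> simp_all
  choose x hx using hbranch
  have hxinj : Function.Injective x := fun a b hab =>
    hg (Sum.inl.inj (hφ (by rw [hx, hx, hab])))
  have hxadj : ∀ a b, a ≠ b → H.Adj (x a) (x b) := by
    intro a b hab
    obtain ⟨e, he⟩ := exists_edge_of_adj (hadj a b hab)
    have hends : ∀ a b, e.1.1 = g a → e.1.2 = g b → a ≠ b → H.Adj (x a) (x b) := by
      intro a b h1 h2 hab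
      refine adj_of_short_walk (hxinj.ne hab) (fun i => φ (subdivPath t e i)) (t e + 1)
        (Nat.succ_le_succ (ht e)) ?_ ?_ ?_
      · simp only [subdivPath_zero, h1, hx]
      · simp only [subdivPath_of_gt (Nat.lt_succ_self (t e)), h2, hx]
      · exact fun i hi => φ.map_adj (subdivPath_adj (Nat.lt_succ_iff.1 hi))
    rcases Sym2.eq_iff.1 he with ⟨h1, h2⟩ | ⟨h1, h2⟩
    · exact hends a b h1 h2 hab
    · exact (hends b a h1 h2 hab.symm).symm
  have : omegaNum K ≤ omegaNum H :=
    le_omegaNum ⟨⟨x, fun {a b} hab => hxadj a b (by simpa using hab)⟩, hxinj⟩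
  omega

theorem omegaTM_le_of_isSubgraphOf_subdiv {W : Type*} {m r : ℕ} {G : SimpleGraph W}
    {H : SimpleGraph (Fin m)} (hG : IsSubgraphOf G (Subdiv H fun _ => r)) :
    omegaTM r G ≤ max (omegaNum H) 3 := by
  obtain ⟨ψ, hψ⟩ := hG
  refine csSup_le' ?_
  rintro _ ⟨k, K, ⟨t, ht, φ, hφ⟩, rfl⟩
  exact omegaNum_le_of_subdiv_isSubgraphOf ht ⟨ψ.comp φ, hψ.comp hφ⟩

/-! ## Colorings from low tree-depth colorings of subdivisions -/

theorem exists_coloring_of_treeDepthLE {m r : ℕ} {W : Type*} [Finite W]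
    {H : SimpleGraph (Fin m)} {G : SimpleGraph W} (φ : Subdiv H (fun _ => r) →g G)
    (hφ : Function.Injective φ) (A : Set W) {h : ℕ} (hA : TreeDepthLE (G.induce A) h) :
    ∃ col : Fin m → Fin (h + 1), ∀ e : Edges H,
      (∀ i, φ (subdivPath (fun _ => r) e i) ∈ A) → col e.1.1 ≠ col e.1.2 := by
  obtain ⟨R₀, ⟨hrefl, hanti, htrans, hforest⟩, hcomp, hheight⟩ := hA
  let R : W → W → Prop := fun x y => ∃ hx hy, R₀ ⟨x, hx⟩ ⟨y, hy⟩
  have Rrefl : ∀ x ∈ A, R x x := fun x hx => ⟨hx, hx, hrefl _⟩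
  have Ranti : ∀ x y, R x y → R y x → x = y := by
    rintro x y ⟨hx, hy, h1⟩ ⟨_, _, h2⟩
    exact congrArg Subtype.val (hanti _ _ h1 h2)
  have Rtrans : ∀ x y z, R x y → R y z → R x z := by
    rintro x y z ⟨hx, _, h1⟩ ⟨_, hz, h2⟩
    exact ⟨hx, hz, htrans _ _ _ h1 h2⟩
  have Rforest : ∀ x y z, R x z → R y z → R x y ∨ R y x := by
    rintro x y z ⟨hx, _, h1⟩ ⟨hy, _, h2⟩
    exact (hforest _ _ _ h1 h2).imp (fun h => ⟨hx, hy, h⟩) fun h => ⟨hy, hx, h⟩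
  have Rheight : ∀ y, {x | R x y}.ncard ≤ h := by
    intro y
    by_cases hy : y ∈ A
    · refine le_trans (le_of_eq ?_) (hheight ⟨y, hy⟩)
      rw [← Set.ncard_image_of_injective _ Subtype.val_injective]
      congr 1
      ext x
      constructor
      · rintro ⟨hx, _, h1⟩
        exact ⟨⟨x, hx⟩, h1, rfl⟩
      · rintro ⟨x, h1, rfl⟩
        exact ⟨x.2, hy, h1⟩
    · have : {x | R x y} = ∅ := Set.eq_empty_of_forall_notMem fun x hx => hy hx.2.1
      simp [this]
  let L : SimpleGraph (Fin m) := SimpleGraph.fromRel fun u v =>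
    ∃ e : Edges H, e.1 = (u, v) ∧ ∀ i, φ (subdivPath (fun _ => r) e i) ∈ A
  have hL : L.Colorable (h + 1) := by
    refine colorable_of_degenerate L h fun S hS => ?_
    obtain ⟨u, hu, hmax⟩ := S.exists_max_image (fun u => {x | R x (φ (Sum.inl u))}.ncard) hS
    refine ⟨u, hu, ?_⟩
    have hz : ∀ v ∈ {v | v ∈ S ∧ L.Adj u v}, ∃ z, R (φ z) (φ (Sum.inl u)) ∧
        LiesToward (fun _ => r) u z v := by
      rintro v ⟨hv, huv⟩
      obtain ⟨hne, huv⟩ := (fromRel_adj _ _ _).1 huv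
      obtain ⟨e, he, hpath⟩ : ∃ e : Edges H, s(e.1.1, e.1.2) = s(u, v) ∧
          ∀ i, φ (subdivPath (fun _ => r) e i) ∈ A := by
        rcases huv with ⟨e, he, hp⟩ | ⟨e, he, hp⟩
        · exact ⟨e, by rw [he], hp⟩
        · exact ⟨e, by rw [he, Sym2.eq_swap], hp⟩
      obtain ⟨j, -, hj⟩ := exists_min_of_comparable Rtrans Rforest
        (fun i => φ (subdivPath (fun _ => r) e i)) (r + 1) (fun i => Rrefl _ (hpath i))
        (fun i hi => by
          have h1 := φ.map_adj (subdivPath_adj (t := fun _ => r) (e := e) (Nat.lt_succ_iff.1 hi))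
          refine (hcomp ⟨_, hpath i⟩ ⟨_, hpath (i + 1)⟩ h1).imp ?_ ?_
          · exact fun h => ⟨_, _, h⟩
          · exact fun h => ⟨_, _, h⟩)
      have hj1 := hj 0 (Nat.zero_le _)
      have hj2 := hj (r + 1) le_rfl
      simp only [subdivPath_zero] at hj1
      simp only [subdivPath_of_gt (t := fun _ => r) (e := e) (Nat.lt_succ_self r)] at hj2
      have hends : R (φ (subdivPath (fun _ => r) e j)) (φ (Sum.inl u)) ∧
          R (φ (subdivPath (fun _ => r) e j)) (φ (Sum.inl v)) := by
        rcases Sym2.eq_iff.1 he with ⟨h1, h2⟩ | ⟨h1, h2⟩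
        · exact ⟨h1 ▸ hj1, h2 ▸ hj2⟩
        · exact ⟨h2 ▸ hj2, h1 ▸ hj1⟩
      refine ⟨_, hends.1, liesToward_subdivPath he fun heq => ?_⟩
      rw [heq] at hends
      have hlt : {x | R x (φ (Sum.inl u))}.ncard < {x | R x (φ (Sum.inl v))}.ncard := by
        refine Set.ncard_lt_ncard ⟨fun x hx => Rtrans _ _ _ hx hends.2, fun hsub => hne ?_⟩
          (Set.toFinite _)
        obtain ⟨hx, hy, h1⟩ := hends.2
        exact Sum.inl.inj (hφ (Ranti _ _ hends.2 (hsub (Rrefl _ hy))))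
      exact absurd (hmax v hv) (not_le.2 hlt)
    have : Nonempty (Fin m ⊕ Σ _ : Edges H, Fin r) := ⟨Sum.inl u⟩
    choose! z hz1 hz2 using hz
    refine le_trans (Set.ncard_le_ncard_of_injOn (fun v => φ (z v)) (fun v hv => hz1 v hv) ?_
      (Set.toFinite _)) (Rheight (φ (Sum.inl u)))
    intro v hv v' hv' heq
    have h1 := hz2 v hv
    rw [hφ heq] at h1
    exact h1.unique (hz2 v' hv')
  obtain ⟨col⟩ := hL
  refine ⟨col, fun e he => col.valid ?_⟩
  exact (fromRel_adj _ _ _).2 ⟨e.2.1.ne, Or.inl ⟨e, rfl, he⟩⟩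

theorem colorable_of_subdiv_coloring {m r N : ℕ} {W : Type*} [Finite W]
    {H : SimpleGraph (Fin m)} {G : SimpleGraph W} (φ : Subdiv H (fun _ => r) →g G)
    (hφ : Function.Injective φ) (c : W → Fin N)
    (hc : ∀ I : Finset (Fin N), I.card ≤ r + 1 →
      TreeDepthLE (G.induce {v | c v ∈ I}) I.card) :
    H.Colorable (Fintype.card (Fin N × ((I : Finset (Fin N)) → Fin (I.card + 1)))) := by
  have hcol : ∀ I : Finset (Fin N), ∃ col : Fin m → Fin (I.card + 1), I.card ≤ r + 1 →
      ∀ e : Edges H, (∀ i, φ (subdivPath (fun _ => r) e i) ∈ {v | c v ∈ I}) →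
        col e.1.1 ≠ col e.1.2 := by
    intro I
    by_cases hI : I.card ≤ r + 1
    · obtain ⟨col, h⟩ := exists_coloring_of_treeDepthLE φ hφ _ (hc I hI)
      exact ⟨col, fun _ => h⟩
    · exact ⟨fun _ => 0, fun h => absurd h hI⟩
  choose col hcol using hcol
  let c' : Fin m → Fin N × ((I : Finset (Fin N)) → Fin (I.card + 1)) :=
    fun v => (c (φ (Sum.inl v)), fun I => col I v)
  have hc' : ∀ e : Edges H, c' e.1.1 ≠ c' e.1.2 := by
    intro e heq
    have h1 : c (φ (Sum.inl e.1.1)) = c (φ (Sum.inl e.1.2)) := congrArg Prod.fst heq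
    have h2 := congrArg Prod.snd heq
    let d : ℕ → Fin N := fun i => c (φ (subdivPath (fun _ => r) e i))
    let I : Finset (Fin N) := (Finset.range (r + 1)).image d
    have hI : I.card ≤ r + 1 := Finset.card_image_le.trans (Finset.card_range _).le
    have hmem : ∀ i < r + 1, d i ∈ I := fun i hi =>
      Finset.mem_image_of_mem d (Finset.mem_range.2 hi)
    refine hcol I hI e (fun i => ?_) (congrFun h2 I)
    rcases Nat.lt_or_ge i (r + 1) with hi | hi
    · exact hmem i hi
    · have hd : d i = d 0 := by
        simp only [d]
        rw [subdivPath_zero, subdivPath_of_gt (t := fun _ => r) (e := e) hi, h1]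
      exact (congrArg (· ∈ I) hd).mpr (hmem 0 (Nat.succ_pos r))
  refine (Coloring.mk c' fun {u v} huv => ?_ : H.Coloring _).colorable
  rcases lt_or_gt_of_ne huv.ne with h | h
  · exact hc' ⟨(u, v), h, huv⟩
  · exact (hc' ⟨(v, u), h, huv.symm⟩).symm

/-! ## Subdivisions of induced subgraphs -/

/-- An induced subgraph has a copy that sits order-preservingly in the ambient graph. -/
theorem exists_iso_comap_strictMono {m n : ℕ} {H : SimpleGraph (Fin m)}
    {H' : SimpleGraph (Fin n)} (g : H ↪g H') :
    ∃ o : Fin m ↪o Fin n, Nonempty (H ≃g H'.comap o) := by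
  let S : Finset (Fin n) := Finset.univ.map g.toEmbedding
  have hS : S.card = m := by simp [S]
  have hmem : ∀ v, g v ∈ S := fun v => Finset.mem_map.2 ⟨v, Finset.mem_univ _, rfl⟩
  let o := S.orderEmbOfFin hS
  let f : Fin m → Fin m := fun v => (S.orderIsoOfFin hS).symm ⟨g v, hmem v⟩
  have hof : ∀ v, o (f v) = g v := fun v => by
    simp [o, f, ← Finset.coe_orderIsoOfFin_apply]
  have hf : Function.Injective f := fun u v huv => g.injective (by rw [← hof, ← hof, huv])
  refine ⟨o, ⟨⟨Equiv.ofBijective f (Finite.injective_iff_bijective.1 hf), ?_⟩⟩⟩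
  intro u v
  simp [hof]

theorem subdiv_comap_isInducedSubgraphOf {m n : ℕ} (H' : SimpleGraph (Fin n))
    (o : Fin m ↪o Fin n) (r : ℕ) :
    IsInducedSubgraphOf (Subdiv (H'.comap o) fun _ => r) (Subdiv H' fun _ => r) := by
  let E : Edges (H'.comap o) → Edges H' := fun e =>
    ⟨(o e.1.1, o e.1.2), o.strictMono e.2.1, e.2.2⟩
  have hE : Function.Injective E := by
    intro e e' h
    have h1 := congrArg Subtype.val h
    exact Subtype.ext (Prod.ext (o.injective (congrArg Prod.fst h1))
      (o.injective (congrArg Prod.snd h1)))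
  let F : (Fin m ⊕ Σ _ : Edges (H'.comap o), Fin r) → (Fin n ⊕ Σ _ : Edges H', Fin r) :=
    Sum.map o (Sigma.map E fun _ => id)
  have hF : Function.Injective F :=
    Sum.map_injective.2 ⟨o.injective, hE.sigma_map fun _ => Function.injective_id⟩
  have hrel : ∀ a b, subdivRel H' (fun _ => r) (F a) (F b) ↔
      subdivRel (H'.comap o) (fun _ => r) a b := by
    rintro (u | ⟨e, i⟩) (v | ⟨e', j⟩)
    · simp [F, subdivRel]
    · simp [F, subdivRel, Sigma.map, E]
    · simp [F, subdivRel, Sigma.map]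
    · simp [F, subdivRel, Sigma.map, hE.eq_iff]
  refine ⟨⟨⟨F, hF⟩, ?_⟩⟩
  intro a b
  simp only [Subdiv, fromRel_adj, Function.Embedding.coeFn_mk, hrel, hF.ne_iff]

/-- If `𝒞` is hereditary and `χ_p(G) ≤ f(ω(TM_{p-1}(G)))` for all `G ∈ 𝒞`,
then the class `ITM_{p-1}^e(𝒞)` is `χ`-bounded. -/
theorem itm_chi_bounded (C : GraphClass) (hC : Hereditary C) (p : ℕ) (hp : 1 ≤ p)
    (f : ℕ → ℕ)
    (hf : ∀ ⦃n : ℕ⦄ (G : SimpleGraph (Fin n)), G ∈ C n →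
      chiP G p ≤ f (omegaTM (p - 1) G)) :
    ChiBounded (fun m => {H : SimpleGraph (Fin m) | MemITMClass (p - 1) C H}) := by
  obtain ⟨r, rfl⟩ : ∃ r, p = r + 1 := ⟨p - 1, by omega⟩
  rw [Nat.add_sub_cancel] at hf ⊢
  let colors : ℕ → ℕ := fun N =>
    Fintype.card (Fin N × ((I : Finset (Fin N)) → Fin (I.card + 1)))
  refine ⟨fun w => (Finset.range (max w 3 + 1)).sup fun k => (Finset.range (f k + 1)).sup colors,
    ?_⟩
  rintro n H' ⟨n₀, G₀, hG₀, ⟨ι⟩⟩ m H ⟨g⟩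
  obtain ⟨o, ⟨iso⟩⟩ := exists_iso_comap_strictMono g
  obtain ⟨κ⟩ := subdiv_comap_isInducedSubgraphOf H' o r
  let e := Finite.equivFin (Fin m ⊕ Σ _ : Edges (H'.comap o), Fin r)
  let G := (Subdiv (H'.comap o) fun _ => r).comap e.symm
  let θ : G ≃g Subdiv (H'.comap o) fun _ => r := SimpleGraph.Iso.comap e.symm _
  have hG : G ∈ C _ := hC G₀ G hG₀ ⟨(ι.comp κ).comp θ.toEmbedding⟩
  have hTM : omegaTM r G ≤ max (omegaNum H) 3 := by
    rw [omegaNum_congr iso]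
    exact omegaTM_le_of_isSubgraphOf_subdiv ⟨θ.toHom, θ.injective⟩
  obtain ⟨c, hc⟩ := exists_coloring_chiP G (r + 1)
  have hcol : (H'.comap o).Colorable (colors (chiP G (r + 1))) :=
    colorable_of_subdiv_coloring θ.symm.toHom θ.symm.injective c hc
  have hH : H.Colorable (colors (chiP G (r + 1))) := hcol.of_hom iso.toHom
  refine hH.chi_le.trans ?_
  refine le_trans ?_ (Finset.le_sup (f := fun k => (Finset.range (f k + 1)).sup colors)
    (Finset.mem_range.2 (Nat.lt_succ_iff.2 hTM)))
  exact Finset.le_sup (f := colors) (Finset.mem_range.2 (Nat.lt_succ_iff.2 (hf G hG)))
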